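/- A morphism of schemes that is both a universal homeomorphism and étale is an isomorphism. -/

import Mathlib

open AlgebraicGeometry CategoryTheory

/-- a morphism of schemes that is both a universal homeomorphism and
étale is an isomorphism. -/
theorem statement14 {X Y : Scheme} (f : X ⟶ Y)
    (huniv : (AlgebraicGeometry.topologically @IsHomeomorph).universally f)
    (hetale : IsEtale f) : IsIso f := by
  have : Etale f := hetale
  have : UniversallyInjective f :=
    ⟨MorphismProperty.universally_mono (fun _ _ _ h ↦ h.injective) f huniv⟩
  have : Surjective (Limits.pullback.diagonal f) := (UniversallyInjective.iff_diagonal f).mp this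
  have : IsIso (Limits.pullback.diagonal f) :=
    (isIso_iff_isOpenImmersion_and_surjective _).mpr ⟨inferInstance, inferInstance⟩
  have : Mono f := (Limits.pullback.isIso_diagonal_iff f).mp this
  have : Surjective f := ⟨(huniv _ _ _ .of_id_snd : IsHomeomorph f).surjective⟩
  have : IsOpenImmersion f := .of_flat_of_mono f
  exact (isIso_iff_isOpenImmersion_and_surjective f).mpr ⟨inferInstance, inferInstance⟩
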